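/- Let a = 3 and let t ≥ 3 be an integer with t ≡ 3 (mod 6). Set k = ⌈ t(a²−1)/(24a) ⌉ = ⌈ t/9 ⌉, and let b be the residue with 0 ≤ b < 3 and b ≡ (t/3)·8^{−1} (mod 3). Then there exist ε_{d,j} ∈ {0,1}, indexed by divisors d ∈ {1,3} of 3 and integers 0 ≤ j ≤ ⌊k/d⌋, with ε_{1,0} = 1 and ε_{d,j} = 0 whenever 3t/d − 24j < 0, such that for every integer n ≥ 0 one has p_t(3n + b) ≡ ∑_{d ∈ {1,3}} ∑_{0 ≤ j ≤ ⌊k/d⌋, d | (n + k − dj)} ε_{d,j} · p_{3t/d − 24j}((n + k − dj)/d) (mod 2), where the summand is omitted when d does not divide n + k − dj; equivalently, q^k ∑_{n≥0} p_t(3n+b) q^n ≡ ∑_{d|3} ∑_{j=0}^{⌊k/d⌋} ε_{d,j} q^{dj} / ∏_{i≥1}(1 − q^{di})^{3t/d − 24j} (mod 2) as formal power series. -/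

import Mathlib

/-- Number of `t`-tuples of partitions with total size `n`, i.e. the
`t`-multipartition function `p_t(n)` (with `p_0(0) = 1`, `p_0(n) = 0` for `n ≥ 1`). -/
def multipartition (t n : ℕ) : ℕ :=
  ∑ v ∈ Finset.Nat.antidiagonalTuple t n, ∏ i, Fintype.card (Nat.Partition (v i))

open PowerSeries

/-- The generating function of the number of partitions, reduced modulo `2`. -/
noncomputable def partitionSeries : (ZMod 2)⟦X⟧ :=
  PowerSeries.mk fun n ↦ (Fintype.card (Nat.Partition n) : ZMod 2)

theorem coeff_partitionSeries_pow (t n : ℕ) :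
    coeff n (partitionSeries ^ t) = (multipartition t n : ZMod 2) := by
  have h := coeff_prod (fun _ : Fin t ↦ partitionSeries) n Finset.univ
  rw [Finset.prod_const, Finset.card_univ, Fintype.card_fin] at h
  rw [h, multipartition, Nat.cast_sum]
  refine Finset.sum_bij' (fun l _ ↦ ⇑l) (fun v _ ↦ Finsupp.equivFunOnFinite.symm v) ?_ ?_ ?_ ?_ ?_
  · intro l hl
    simpa [Finset.Nat.mem_antidiagonalTuple] using (Finset.mem_finsuppAntidiag.1 hl).1
  · intro v hv
    simpa [Finset.mem_finsuppAntidiag, Finset.Nat.mem_antidiagonalTuple] using hv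
  · intro l _
    ext; simp
  · intro v _
    ext; simp
  · intro l _
    simp [partitionSeries]

theorem partitionSeries_mul_pentagonalSeries :
    partitionSeries * pentagonalSeries (ZMod 2) = 1 := by
  let : TopologicalSpace (ZMod 2) := ⊥
  have : DiscreteTopology (ZMod 2) := ⟨rfl⟩
  open WithPiTopology in
  have h := (Nat.Partition.hasProd_powerSeriesMk_card_restricted (ZMod 2) fun _ ↦ True).mul
    (hasProd_one_sub_X_pow (ZMod 2))
  have hone (i : ℕ) : (∑' j : ℕ, (X : (ZMod 2)⟦X⟧) ^ ((i + 1) * j)) * (1 - X ^ (i + 1)) = 1 := by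
    simp_rw [pow_mul]
    open WithPiTopology in
    exact tsum_pow_mul_one_sub_of_constantCoeff_eq_zero (by simp)
  simp only [if_true, hone] at h
  have h2 := h.unique hasProd_one
  simpa [partitionSeries, Nat.Partition.restricted, Finset.filter_true] using h2

open Classical in
theorem coeff_pentagonalSeries_zmod_two (n : ℕ) :
    coeff n (pentagonalSeries (ZMod 2)) = if ∃ k : ℤ, 2 * (n : ℤ) = k * (3 * k - 1) then 1 else 0 := by
  split_ifs with h
  · obtain ⟨k, hk⟩ := h
    have : n = pentagonal k := by
      have := two_mul_natCast_pentagonal k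
      omega
    rw [this, coeff_pentagonalSeries_pentagonal, Int.coe_negOnePow]
    simp
  · apply coeff_pentagonalSeries_eq_zero
    rintro ⟨k, rfl⟩
    exact h ⟨k, two_mul_natCast_pentagonal k⟩

open Classical in
/-- The generating function of the triangular numbers, with coefficients in `ZMod 2`. -/
noncomputable def triangularSeries : (ZMod 2)⟦X⟧ :=
  PowerSeries.mk fun n ↦ if ∃ k : ℤ, 2 * (n : ℤ) = k * (k + 1) then 1 else 0

/-- The integer points `(k, m)` for which the pentagonal number of index `k` and the triangular
number of index `2 * m - 3 * k` add up to `n`. -/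
def pentagonalTriangularPairs (n : ℕ) : Set (ℤ × ℤ) :=
  {p | (n : ℤ) = 6 * p.1 ^ 2 - 2 * p.1 + 2 * p.2 ^ 2 - 6 * p.1 * p.2 + p.2}

theorem mem_pentagonalTriangularPairs {n : ℕ} {k m : ℤ} :
    (k, m) ∈ pentagonalTriangularPairs n ↔
      (n : ℤ) = 6 * k ^ 2 - 2 * k + 2 * m ^ 2 - 6 * k * m + m :=
  Iff.rfl

theorem bijOn_pentagonalTriangularPairs (n : ℕ) :
    Set.BijOn (fun p : ℤ × ℤ ↦ (pentagonal p.1,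
        ((2 * p.2 - 3 * p.1) * (2 * p.2 - 3 * p.1 + 1) / 2).toNat))
      (pentagonalTriangularPairs n)
      {x : ℕ × ℕ | x.1 + x.2 = n ∧ (∃ k : ℤ, 2 * (x.1 : ℤ) = k * (3 * k - 1)) ∧
        ∃ k : ℤ, 2 * (x.2 : ℤ) = k * (k + 1)} := by
  have htri (r : ℤ) : 2 * (((r * (r + 1) / 2).toNat : ℕ) : ℤ) = r * (r + 1) := by
    have h0 : 0 ≤ r * (r + 1) := by
      rcases le_or_gt 0 r with h | h <;> nlinarith
    have := Int.two_mul_ediv_two_of_even (Int.even_mul_succ_self r)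
    omega
  refine ⟨?_, ?_, ?_⟩
  · rintro ⟨k, m⟩ h
    have h1 := two_mul_natCast_pentagonal k
    have h2 := htri (2 * m - 3 * k)
    refine ⟨?_, ⟨k, h1⟩, ⟨_, h2⟩⟩
    rw [mem_pentagonalTriangularPairs] at h
    zify
    linarith
  · rintro ⟨k, m⟩ - ⟨k', m'⟩ - h
    simp only [Prod.mk.injEq, pentagonal_inj] at h
    obtain ⟨rfl, h⟩ := h
    have h1 := htri (2 * m - 3 * k)
    have h2 := htri (2 * m' - 3 * k)
    rw [h, h2] at h1
    have : (m - m') * (2 * (2 * m + 2 * m' - 6 * k + 1)) = 0 := by linarith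
    rcases mul_eq_zero.1 this with h | h
    · simp only [Prod.mk.injEq, true_and]; omega
    · omega
  · rintro ⟨i, j⟩ ⟨hn, ⟨k, hk⟩, ⟨r, hr⟩⟩
    obtain ⟨m, hm⟩ : ∃ m : ℤ, 2 * (j : ℤ) = (2 * m - 3 * k) * (2 * m - 3 * k + 1) := by
      rcases Int.even_or_odd' (r + 3 * k) with ⟨m, h | h⟩
      · exact ⟨m, by rw [hr, show r = 2 * m - 3 * k by omega]⟩
      · exact ⟨3 * k - m - 1, by rw [hr, show r = 2 * m + 1 - 3 * k by omega]; ring⟩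
    refine ⟨(k, m), ?_, ?_⟩
    · rw [mem_pentagonalTriangularPairs]
      simp only at hn
      zify at hn
      linarith
    · have h1 := two_mul_natCast_pentagonal k
      have h2 := htri (2 * m - 3 * k)
      simp only [Prod.mk.injEq]
      constructor <;> omega

open Classical in
theorem pentagonalSeries_mul_triangularSeries :
    pentagonalSeries (ZMod 2) * triangularSeries =
      expand 4 (by norm_num) (pentagonalSeries (ZMod 2)) := by
  ext n
  have hbij := bijOn_pentagonalTriangularPairs n
  have hfin : (pentagonalTriangularPairs n).Finite := by
    refine hbij.finite_iff_finite.2 ((Finset.finite_toSet (Finset.HasAntidiagonal.antidiagonal n)).subset fun x hx ↦ ?_)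
    simpa using hx.1
  have hcount : coeff n (pentagonalSeries (ZMod 2) * triangularSeries) =
      ∑ p ∈ hfin.toFinset, (1 : ZMod 2) := by
    simp_rw [coeff_mul, coeff_pentagonalSeries_zmod_two, triangularSeries, coeff_mk,
      ite_zero_mul_ite_zero, mul_one]
    rw [← Finset.sum_filter]
    symm
    refine Finset.sum_nbij (fun p : ℤ × ℤ ↦ (pentagonal p.1,
      ((2 * p.2 - 3 * p.1) * (2 * p.2 - 3 * p.1 + 1) / 2).toNat)) ?_ ?_ ?_ fun _ _ ↦ rfl
    rotate_left
    · rw [hfin.coe_toFinset]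
      exact hbij.injOn
    · rw [hfin.coe_toFinset]
      convert hbij.surjOn using 1
      ext x
      simp
    · intro p hp
      simpa using hbij.mapsTo (hfin.mem_toFinset.1 hp)
  have hcancel : ∑ p ∈ hfin.toFinset with ¬ p.2 = 0, (1 : ZMod 2) = 0 := by
    refine Finset.sum_involution (fun p _ ↦ (p.1 - p.2, -p.2)) (fun _ _ ↦ by decide) ?_ ?_ ?_
    · rintro ⟨k, m⟩ hp - h
      simp only [Finset.mem_filter, Prod.mk.injEq] at hp h
      omega
    · rintro ⟨k, m⟩ hp
      simp only [Finset.mem_filter, Set.Finite.mem_toFinset, mem_pentagonalTriangularPairs] at hp ⊢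
      exact ⟨by linear_combination hp.1, by simpa using hp.2⟩
    · rintro ⟨k, m⟩ hp
      simp
  rw [hcount, ← Finset.sum_filter_add_sum_filter_not _ (fun p : ℤ × ℤ ↦ p.2 = 0), hcancel, add_zero,
    coeff_expand, coeff_pentagonalSeries_zmod_two]
  have hmem (p : ℤ × ℤ) : p ∈ hfin.toFinset.filter (fun p ↦ p.2 = 0) ↔
      (n : ℤ) = 2 * (p.1 * (3 * p.1 - 1)) ∧ p.2 = 0 := by
    obtain ⟨k, m⟩ := p
    simp only [Finset.mem_filter, Set.Finite.mem_toFinset, mem_pentagonalTriangularPairs]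
    refine and_congr_left ?_
    rintro rfl
    ring_nf
  rw [← ite_and]
  split_ifs with h
  · obtain ⟨⟨j, rfl⟩, k, hk⟩ := h
    rw [Nat.mul_div_cancel_left _ (by norm_num)] at hk
    suffices hfin.toFinset.filter (fun p ↦ p.2 = 0) = {(k, 0)} by simp [this]
    ext ⟨k', m⟩
    rw [hmem]
    simp only [Finset.mem_singleton, Prod.mk.injEq]
    refine and_congr_left fun _ ↦ ?_
    rw [← pentagonal_inj (x := k')]
    have h1 := two_mul_natCast_pentagonal k
    have h2 := two_mul_natCast_pentagonal k'
    push_cast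
    omega
  · rw [Finset.sum_eq_zero]
    intro p hp
    have hp := ((hmem p).1 hp).1
    have h1 := two_mul_natCast_pentagonal p.1
    refine absurd ⟨⟨pentagonal p.1, by omega⟩, p.1, by omega⟩ h

theorem pow_four_eq_expand (f : (ZMod 2)⟦X⟧) : f ^ 4 = expand 4 (by norm_num) f := by
  have h := MvPowerSeries.map_iterateFrobenius_expand 2 (by norm_num) f 2
  rw [Subsingleton.elim (iterateFrobenius (ZMod 2) 2 2) (RingHom.id _), MvPowerSeries.map_id] at h
  exact h.symm

theorem pentagonalSeries_pow_three : pentagonalSeries (ZMod 2) ^ 3 = triangularSeries := by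
  have hne : pentagonalSeries (ZMod 2) ≠ 0 := fun h ↦ by
    simpa [h] using coeff_pentagonalSeries_pentagonal (ZMod 2) 0
  refine mul_left_cancel₀ hne ?_
  rw [pentagonalSeries_mul_triangularSeries, ← pow_four_eq_expand, ← pow_succ']

open Classical in
theorem triangularSeries_eq :
    triangularSeries = expand 3 (by norm_num) (pentagonalSeries (ZMod 2)) +
      X * expand 3 (by norm_num) (expand 3 (by norm_num) triangularSeries) := by
  ext n
  rw [← expand_mul, map_add]
  rcases n with _ | n
  · rw [coeff_zero_X_mul, add_zero, coeff_expand, coeff_pentagonalSeries_zmod_two,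
      triangularSeries, coeff_mk, if_pos ⟨0, by simp⟩, if_pos (by simp), if_pos ⟨0, by simp⟩]
  · rw [coeff_succ_X_mul, coeff_expand, coeff_expand, coeff_pentagonalSeries_zmod_two,
      triangularSeries, coeff_mk, coeff_mk, ← ite_and, ← ite_and]
    by_cases h1 : 3 ∣ n + 1 ∧ ∃ k : ℤ, 2 * (((n + 1) / 3 : ℕ) : ℤ) = k * (3 * k - 1)
    · obtain ⟨hd, k, hk⟩ := h1
      rw [if_pos ⟨3 * k - 1, by push_cast; grind⟩, if_pos ⟨hd, k, hk⟩,
        if_neg (fun h ↦ by omega), add_zero]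
    rw [if_neg h1, zero_add]
    refine if_congr ⟨?_, ?_⟩ rfl rfl
    · rintro ⟨k, hk⟩
      obtain ⟨r, rfl | rfl | rfl⟩ : ∃ r, k = 3 * r ∨ k = 3 * r + 1 ∨ k = 3 * r - 1 :=
        ⟨(k + 1) / 3, by omega⟩
      · have h2 := two_mul_natCast_pentagonal (-r)
        refine absurd ⟨⟨pentagonal (-r), ?_⟩, -r, ?_⟩ h1 <;> grind
      · obtain ⟨c, hc⟩ := Int.even_mul_succ_self r
        have h2 : (n : ℤ) = 9 * c := by push_cast at hk; linarith
        exact ⟨by omega, r, by grind⟩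
      · have h2 := two_mul_natCast_pentagonal r
        refine absurd ⟨⟨pentagonal r, ?_⟩, r, ?_⟩ h1 <;> grind
    · rintro ⟨⟨c, hc⟩, r, hr⟩
      refine ⟨3 * r + 1, ?_⟩
      subst hc
      rw [Nat.mul_div_cancel_left _ (by norm_num)] at hr
      push_cast
      linear_combination 9 * hr

/-- The substitution `X ↦ X ^ 3`. -/
noncomputable abbrev cubeArg : (ZMod 2)⟦X⟧ →ₐ[ZMod 2] (ZMod 2)⟦X⟧ :=
  expand 3 (by norm_num)

/-- The operator sending `∑ aₙ Xⁿ` to `∑ a₃ₙ Xⁿ`. -/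
noncomputable def trisect : (ZMod 2)⟦X⟧ →+ (ZMod 2)⟦X⟧ where
  toFun f := PowerSeries.mk fun n ↦ coeff (3 * n) f
  map_zero' := by ext; simp
  map_add' f g := by ext; simp

theorem coeff_trisect (f : (ZMod 2)⟦X⟧) (n : ℕ) : coeff n (trisect f) = coeff (3 * n) f := by
  simp [trisect]

theorem trisect_cubeArg (f : (ZMod 2)⟦X⟧) : trisect (cubeArg f) = f := by
  ext n
  rw [coeff_trisect, coeff_expand_mul]

theorem trisect_cubeArg_mul (f g : (ZMod 2)⟦X⟧) : trisect (cubeArg f * g) = f * trisect g := by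
  ext n
  rw [coeff_trisect, coeff_mul, coeff_mul]
  symm
  refine Finset.sum_of_injOn (fun p ↦ (3 * p.1, 3 * p.2)) ?_ ?_ ?_ ?_
  · rintro ⟨a, b⟩ - ⟨c, d⟩ - h
    simpa using h
  · rintro ⟨a, b⟩ h
    rw [Finset.mem_coe, Finset.HasAntidiagonal.mem_antidiagonal] at h ⊢
    simp only at h ⊢
    omega
  · rintro ⟨a, b⟩ h hn
    rw [coeff_expand_of_not_dvd, zero_mul]
    rintro ⟨c, rfl⟩
    refine hn ⟨(c, n - c), ?_⟩
    rw [Finset.HasAntidiagonal.mem_antidiagonal] at h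
    simp only at h
    rw [Finset.mem_coe, Finset.HasAntidiagonal.mem_antidiagonal, Prod.mk.injEq]
    omega
  · rintro ⟨a, b⟩ -
    rw [coeff_expand_mul, coeff_trisect]

theorem trisect_X_mul_cubeArg (f : (ZMod 2)⟦X⟧) : trisect (X * cubeArg f) = 0 := by
  ext n
  rw [coeff_trisect, map_zero]
  rcases n with _ | n
  · exact coeff_zero_X_mul _
  · rw [show 3 * (n + 1) = 3 * n + 2 + 1 by ring, coeff_succ_X_mul, coeff_expand_of_not_dvd]
    omega

theorem trisect_X_sq_mul_cubeArg (f : (ZMod 2)⟦X⟧) : trisect (X ^ 2 * cubeArg f) = 0 := by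
  ext n
  rw [coeff_trisect, map_zero, coeff_X_pow_mul']
  split_ifs with h
  · rw [coeff_expand_of_not_dvd]
    omega
  · rfl

theorem eq_zero_of_eq_X_mul_cubeArg {f : (ZMod 2)⟦X⟧} (h : f = X * cubeArg f) : f = 0 := by
  ext n
  induction n using Nat.strong_induction_on with
  | _ n ih =>
    rw [h]
    rcases n with _ | n
    · exact coeff_zero_X_mul _
    · rw [coeff_succ_X_mul, coeff_expand]
      split_ifs
      · exact ih _ (by omega)
      · rfl

theorem two_eq_zero_powerSeries : (2 : (ZMod 2)⟦X⟧) = 0 := by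
  have h := congrArg (C (R := ZMod 2)) (show (2 : ZMod 2) = 0 from rfl)
  rwa [map_ofNat, map_zero] at h

theorem triangularSeries_relation :
    triangularSeries ^ 4 + triangularSeries * cubeArg triangularSeries +
      X * cubeArg triangularSeries ^ 4 = 0 := by
  apply eq_zero_of_eq_X_mul_cubeArg
  have h1 := triangularSeries_eq
  have h2 : cubeArg (pentagonalSeries (ZMod 2)) ^ 3 = cubeArg triangularSeries := by
    rw [← map_pow, pentagonalSeries_pow_three]
  simp only [map_add, map_mul, map_pow, expand_X]
  set c := cubeArg (pentagonalSeries (ZMod 2))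
  set b := cubeArg triangularSeries
  set d := cubeArg b
  rw [h1, ← h2]
  linear_combination (c ^ 4 + 2 * c ^ 3 * X * d + 3 * c ^ 2 * X ^ 2 * d ^ 2 +
    2 * c * X ^ 3 * d ^ 3) * two_eq_zero_powerSeries

/-- The generating function of the number of `3`-multipartitions, reduced modulo `2`. -/
noncomputable def triplePartitionSeries : (ZMod 2)⟦X⟧ :=
  partitionSeries ^ 3

local notation "𝒢" => triplePartitionSeries
local notation "𝒯" => triangularSeries

theorem triplePartitionSeries_mul_triangularSeries : 𝒢 * 𝒯 = 1 := by
  rw [triplePartitionSeries, ← pentagonalSeries_pow_three, ← mul_pow,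
    partitionSeries_mul_pentagonalSeries, one_pow]

theorem cubeArg_triplePartitionSeries_mul : cubeArg 𝒢 * cubeArg 𝒯 = 1 := by
  rw [← map_mul, triplePartitionSeries_mul_triangularSeries, map_one]

theorem X_mul_triplePartitionSeries_pow_four :
    X * 𝒢 ^ 4 = 𝒢 ^ 3 * cubeArg 𝒢 ^ 3 + cubeArg 𝒢 ^ 4 := by
  have h : (𝒢 * 𝒯) ^ 4 * cubeArg 𝒢 ^ 4 +
      𝒢 ^ 3 * cubeArg 𝒢 ^ 3 * (𝒢 * 𝒯) * (cubeArg 𝒢 * cubeArg 𝒯) +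
        X * 𝒢 ^ 4 * (cubeArg 𝒢 * cubeArg 𝒯) ^ 4 = 0 := by
    linear_combination 𝒢 ^ 4 * cubeArg 𝒢 ^ 4 * triangularSeries_relation
  rw [triplePartitionSeries_mul_triangularSeries, cubeArg_triplePartitionSeries_mul] at h
  linear_combination h - (𝒢 ^ 3 * cubeArg 𝒢 ^ 3 + cubeArg 𝒢 ^ 4) * two_eq_zero_powerSeries

theorem trisect_one : trisect 1 = 1 := by
  simpa using trisect_cubeArg 1

theorem X_mul_triplePartitionSeries :
    X * 𝒢 = cubeArg 𝒢 ^ 4 * (𝒯 ^ 3 + cubeArg 𝒯) := by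
  have h : 𝒯 ^ 3 * (𝒢 * 𝒯) * cubeArg 𝒢 ^ 4 + cubeArg 𝒯 * (𝒢 * 𝒯) * cubeArg 𝒢 ^ 4 +
      X * 𝒢 * (cubeArg 𝒢 * cubeArg 𝒯) ^ 4 = 0 := by
    linear_combination 𝒢 * cubeArg 𝒢 ^ 4 * triangularSeries_relation
  rw [triplePartitionSeries_mul_triangularSeries, cubeArg_triplePartitionSeries_mul] at h
  linear_combination h - cubeArg 𝒢 ^ 4 * (𝒯 ^ 3 + cubeArg 𝒯) * two_eq_zero_powerSeries

theorem cubeArg_pentagonalSeries_pow_three :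
    cubeArg (pentagonalSeries (ZMod 2)) ^ 3 = cubeArg 𝒯 := by
  rw [← map_pow, pentagonalSeries_pow_three]

theorem trisect_X_mul_triplePartitionSeries :
    trisect (X * 𝒢) = cubeArg 𝒢 + 𝒢 ^ 3 := by
  have h : X * 𝒢 = cubeArg (𝒢 ^ 4) * (X * cubeArg (pentagonalSeries (ZMod 2) ^ 2 * cubeArg 𝒯) +
      X ^ 2 * cubeArg (pentagonalSeries (ZMod 2) * cubeArg 𝒯 ^ 2) +
        cubeArg (X * cubeArg 𝒯 ^ 3)) := by
    rw [X_mul_triplePartitionSeries]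
    nth_rw 1 [triangularSeries_eq]
    simp only [map_mul, map_pow, expand_X, ← cubeArg_pentagonalSeries_pow_three]
    set c := cubeArg (pentagonalSeries (ZMod 2))
    set d := cubeArg c
    linear_combination cubeArg 𝒢 ^ 4 * (c ^ 3 + c ^ 2 * X * d ^ 3 + c * X ^ 2 * d ^ 6) *
      two_eq_zero_powerSeries
  rw [h, trisect_cubeArg_mul, map_add, map_add, trisect_X_mul_cubeArg, trisect_X_sq_mul_cubeArg,
    trisect_cubeArg]
  have h1 := cubeArg_triplePartitionSeries_mul
  generalize cubeArg 𝒯 = S at *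
  have h2 : S ^ 3 * cubeArg 𝒢 ^ 3 = 1 := by rw [← mul_pow, mul_comm, h1, one_pow]
  linear_combination S ^ 3 * X_mul_triplePartitionSeries_pow_four + (𝒢 ^ 3 + cubeArg 𝒢) * h2

theorem trisect_X_mul_triplePartitionSeries_sq :
    trisect ((X * 𝒢) ^ 2) = cubeArg 𝒢 ^ 2 + (𝒢 ^ 3) ^ 2 := by
  have h : (X * 𝒢) ^ 2 = cubeArg (𝒢 ^ 4) * (X * cubeArg (pentagonalSeries (ZMod 2) ^ 2) +
      cubeArg (X * cubeArg 𝒯 ^ 2) + cubeArg 𝒯 * (X * 𝒢)) := by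
    have h1 : (X * 𝒢) ^ 2 =
        cubeArg 𝒢 ^ 4 * (X * 𝒯 ^ 2 * (𝒢 * 𝒯) + cubeArg 𝒯 * (X * 𝒢)) := by
      linear_combination X * 𝒢 * X_mul_triplePartitionSeries
    rw [h1, triplePartitionSeries_mul_triangularSeries]
    nth_rw 1 [triangularSeries_eq]
    simp only [map_mul, map_pow, expand_X]
    linear_combination cubeArg 𝒢 ^ 4 * X ^ 2 * cubeArg (pentagonalSeries (ZMod 2)) *
      cubeArg (cubeArg 𝒯) * two_eq_zero_powerSeries
  rw [h, trisect_cubeArg_mul, map_add, map_add, trisect_X_mul_cubeArg, trisect_cubeArg,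
    trisect_cubeArg_mul, trisect_X_mul_triplePartitionSeries]
  have h1 := cubeArg_triplePartitionSeries_mul
  have h2 := triplePartitionSeries_mul_triangularSeries
  generalize cubeArg 𝒯 = S at *
  have h3 : S ^ 2 * cubeArg 𝒢 ^ 2 = 1 := by rw [← mul_pow, mul_comm, h1, one_pow]
  linear_combination S ^ 2 * X_mul_triplePartitionSeries_pow_four +
    (𝒢 ^ 3 * cubeArg 𝒢 + cubeArg 𝒢 ^ 2) * h3 + 𝒢 ^ 3 * (cubeArg 𝒢 + 𝒢 ^ 3) * h2 +
    𝒢 ^ 3 * cubeArg 𝒢 * two_eq_zero_powerSeries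

theorem trisect_X_mul_triplePartitionSeries_pow_three :
    trisect ((X * 𝒢) ^ 3) = cubeArg 𝒢 ^ 3 + (𝒢 ^ 3) ^ 3 := by
  have h : (X * 𝒢) ^ 3 = cubeArg (𝒢 ^ 4) * (X ^ 2 * cubeArg (pentagonalSeries (ZMod 2)) +
      cubeArg (X * cubeArg 𝒯) + cubeArg 𝒯 * (X * 𝒢) ^ 2) := by
    have h1 : (X * 𝒢) ^ 3 =
        cubeArg 𝒢 ^ 4 * (X ^ 2 * 𝒯 * (𝒢 * 𝒯) ^ 2 + cubeArg 𝒯 * (X * 𝒢) ^ 2) := by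
      linear_combination (X * 𝒢) ^ 2 * X_mul_triplePartitionSeries
    rw [h1, triplePartitionSeries_mul_triangularSeries]
    nth_rw 1 [triangularSeries_eq]
    simp only [map_mul, map_pow, expand_X]
    ring
  rw [h, trisect_cubeArg_mul, map_add, map_add, trisect_X_sq_mul_cubeArg, trisect_cubeArg,
    trisect_cubeArg_mul, trisect_X_mul_triplePartitionSeries_sq]
  have h1 := cubeArg_triplePartitionSeries_mul
  have h2 := triplePartitionSeries_mul_triangularSeries
  generalize cubeArg 𝒯 = S at *
  linear_combination S * X_mul_triplePartitionSeries_pow_four +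
    (𝒢 ^ 3 * cubeArg 𝒢 ^ 2 + cubeArg 𝒢 ^ 3) * h1 +
    𝒢 ^ 3 * (cubeArg 𝒢 ^ 2 + (𝒢 ^ 3) ^ 2) * h2 +
    𝒢 ^ 3 * cubeArg 𝒢 ^ 2 * two_eq_zero_powerSeries

theorem trisect_X_mul_triplePartitionSeries_pow_add_four (s : ℕ) :
    trisect ((X * 𝒢) ^ (s + 4)) =
      𝒢 ^ 3 * trisect ((X * 𝒢) ^ (s + 3)) + X * 𝒢 ^ 4 * trisect ((X * 𝒢) ^ s) := by
  rw [← trisect_cubeArg_mul, ← trisect_cubeArg_mul, ← map_add]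
  congr 1
  simp only [map_mul, map_pow, expand_X]
  linear_combination X ^ 3 * (X * 𝒢) ^ s * X_mul_triplePartitionSeries_pow_four

theorem exists_trisect_add_eq_sum (s : ℕ) :
    ∃ ε : ℕ → ZMod 2, (0 < s → ε 0 = 1) ∧ (∀ j, s < 4 * j → ε j = 0) ∧
      ∀ K, s < 4 * (K + 1) → trisect ((X * 𝒢) ^ s) + cubeArg 𝒢 ^ s =
        ∑ j ∈ Finset.range (K + 1), C (ε j) * (X ^ j * 𝒢 ^ (3 * s - 8 * j)) := by
  have hsmall (s : ℕ) (h0 : 0 < s)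
      (h : trisect ((X * 𝒢) ^ s) = cubeArg 𝒢 ^ s + (𝒢 ^ 3) ^ s) :
      ∃ ε : ℕ → ZMod 2, (0 < s → ε 0 = 1) ∧ (∀ j, s < 4 * j → ε j = 0) ∧
      ∀ K, s < 4 * (K + 1) → trisect ((X * 𝒢) ^ s) + cubeArg 𝒢 ^ s =
        ∑ j ∈ Finset.range (K + 1), C (ε j) * (X ^ j * 𝒢 ^ (3 * s - 8 * j)) := by
    refine ⟨fun j ↦ if j = 0 then 1 else 0, fun _ ↦ if_pos rfl,
      fun j hj ↦ if_neg (by omega), fun K _ ↦ ?_⟩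
    rw [Finset.sum_range_succ', Finset.sum_eq_zero (by simp), h]
    simp only [if_true, map_one, pow_zero, mul_zero, tsub_zero, pow_mul]
    linear_combination cubeArg 𝒢 ^ s * two_eq_zero_powerSeries
  induction s using Nat.strong_induction_on with
  | _ s ih =>
    match s with
    | 0 =>
      refine ⟨0, by simp, by simp, fun K _ ↦ ?_⟩
      simp only [pow_zero, trisect_one, Pi.zero_apply, map_zero, zero_mul, Finset.sum_const_zero]
      linear_combination two_eq_zero_powerSeries
    | 1 => exact hsmall 1 one_pos (by simpa using trisect_X_mul_triplePartitionSeries)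
    | 2 => exact hsmall 2 two_pos trisect_X_mul_triplePartitionSeries_sq
    | 3 => exact hsmall 3 three_pos trisect_X_mul_triplePartitionSeries_pow_three
    | s + 4 =>
      obtain ⟨ε, h0, hv, hε⟩ := ih (s + 3) (by omega)
      obtain ⟨δ, -, hw, hδ⟩ := ih s (by omega)
      refine ⟨fun j ↦ ε j + if j = 0 then 0 else δ (j - 1), ?_, ?_, ?_⟩
      · intro _
        simpa using h0 (by omega)
      · intro j hj
        change ε j + ite (j = 0) 0 (δ (j - 1)) = 0
        rw [hv j (by omega), if_neg (by omega), hw _ (by omega), add_zero]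
      · intro K hK
        obtain ⟨K, rfl⟩ : ∃ L, K = L + 1 := ⟨K - 1, by omega⟩
        have hrec : trisect ((X * 𝒢) ^ (s + 4)) + cubeArg 𝒢 ^ (s + 4) =
            𝒢 ^ 3 * (trisect ((X * 𝒢) ^ (s + 3)) + cubeArg 𝒢 ^ (s + 3)) +
              X * 𝒢 ^ 4 * (trisect ((X * 𝒢) ^ s) + cubeArg 𝒢 ^ s) := by
          rw [trisect_X_mul_triplePartitionSeries_pow_add_four]
          linear_combination -cubeArg 𝒢 ^ s * X_mul_triplePartitionSeries_pow_four -
            𝒢 ^ 3 * cubeArg 𝒢 ^ (s + 3) * two_eq_zero_powerSeries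
        rw [hrec, hε (K + 1) (by omega), hδ K (by omega)]
        simp only [map_add, add_mul, Finset.sum_add_distrib]
        congr 1
        · rw [Finset.mul_sum]
          refine Finset.sum_congr rfl fun j _ ↦ ?_
          by_cases hj : s + 3 < 4 * j
          · simp [hv j hj]
          · rw [show 3 * (s + 4) - 8 * j = 3 * (s + 3) - 8 * j + 3 by omega]
            ring
        · rw [Finset.mul_sum, Finset.sum_range_succ' _ (K + 1)]
          simp only [if_true, map_zero, zero_mul, add_zero, Nat.add_eq_zero_iff, one_ne_zero,
            and_false, if_false, Nat.add_sub_cancel]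
          refine Finset.sum_congr rfl fun j _ ↦ ?_
          by_cases hj : s < 4 * j
          · simp [hw j hj]
          · rw [show 3 * (s + 4) - 8 * (j + 1) = 3 * s - 8 * j + 4 by omega]
            ring

/-- Chen's theorem for `a = 3` and `t ≡ 3 (mod 6)`, `t ≥ 3`: with
`k = ⌈t/9⌉` and `b` the residue mod `3` of `(t/3)·8⁻¹`, there are
`ε_{d,j} ∈ {0,1}` (for `d ∈ {1,3}`, `0 ≤ j ≤ ⌊k/d⌋`) with `ε_{1,0} = 1`
and `ε_{d,j} = 0` whenever `3t/d − 24j < 0`, such that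
`q^k ∑ p_t(3n+b) qⁿ ≡ ∑_{d∣3} ∑_{j=0}^{⌊k/d⌋} ε_{d,j} q^{dj} / ∏(1−q^{di})^{3t/d−24j} (mod 2)`;
the coefficient of `qⁿ⁺ᵏ` on the right is
`∑_{d∣3} ∑_{j ≤ ⌊k/d⌋, d ∣ n+k−dj} ε_{d,j} p_{3t/d−24j}((n+k−dj)/d)`. -/
theorem chen_identity_three
    (t : ℕ) (ht3 : 3 ≤ t) (ht : t % 6 = 3)
    (k : ℕ) (hk : k = (t + 8) / 9)
    (b : ℕ) (hb : b < 3)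
    (hbmod : (8 * b) % 3 = (t / 3) % 3) :
    ∃ ε : ℕ → ℕ → ZMod 2,
      ε 1 0 = 1 ∧
      (∀ d ∈ Nat.divisors 3, ∀ j ≤ k / d, 3 * t / d < 24 * j → ε d j = 0) ∧
      ∀ n : ℕ,
        (multipartition t (3 * n + b) : ZMod 2) =
          ∑ d ∈ Nat.divisors 3, ∑ j ∈ Finset.range (k / d + 1),
            if d ∣ n + k - d * j then
              ε d j * (multipartition (3 * t / d - 24 * j) ((n + k - d * j) / d) : ZMod 2)
            else 0 := by
  obtain ⟨s, rfl⟩ : ∃ s, t = 3 * s := ⟨t / 3, by omega⟩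
  obtain ⟨ε, hε0, hεv, hε⟩ := exists_trisect_add_eq_sum s
  have hpow (r n : ℕ) : coeff n (𝒢 ^ r) = (multipartition (3 * r) n : ZMod 2) := by
    rw [triplePartitionSeries, ← pow_mul, coeff_partitionSeries_pow]
  have hleft (n : ℕ) : coeff (n + k) (trisect ((X * 𝒢) ^ s)) =
      (multipartition (3 * s) (3 * n + b) : ZMod 2) := by
    rw [coeff_trisect, mul_pow, show 3 * (n + k) = 3 * n + b + s by omega, coeff_X_pow_mul, hpow]
  have hthree (n : ℕ) : coeff (n + k) (cubeArg 𝒢 ^ s) =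
      if 3 ∣ n + k then (multipartition (3 * s) ((n + k) / 3) : ZMod 2) else 0 := by
    rw [← map_pow, coeff_expand, hpow]
  refine ⟨fun d j ↦ if d = 1 then ε j else if j = 0 then 1 else 0, ?_, ?_, fun n ↦ ?_⟩
  · simpa using hε0 (by omega)
  · intro d hd j _ hj
    rw [Nat.Prime.divisors Nat.prime_three, Finset.mem_insert, Finset.mem_singleton] at hd
    rcases hd with rfl | rfl
    · exact hεv j (by omega)
    · simpa using show j ≠ 0 by omega
  · have h := congrArg (coeff (n + k)) (hε k (by omega))
    rw [map_add, hleft, hthree, map_sum] at h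
    rw [Nat.Prime.divisors Nat.prime_three, Finset.sum_pair (by norm_num), eq_sub_of_add_eq h,
      CharTwo.sub_eq_add]
    congr 1
    · rw [Nat.div_one]
      refine Finset.sum_congr rfl fun j hj ↦ ?_
      rw [Finset.mem_range] at hj
      rw [coeff_C_mul, coeff_X_pow_mul', if_pos (by omega), hpow,
        show 3 * (3 * s - 8 * j) = 3 * (3 * s) / 1 - 24 * j by omega]
      simp
    · rw [Finset.sum_range_succ', Finset.sum_eq_zero (by simp)]
      simp
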